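/- Define G₃(y) = Σ_{m=0}^∞ ( (3m)! / (3^m · m!)³ ) (1−y)^m for 0 < y < 1 (this series converges for every y ∈ (0,1)). There is no Lebesgue measurable function u : (0,1) → ℝ satisfying both: (i) ∫₀¹ x^{α−1} G₃(x) |u(x)| dx < ∞ for every α > 0, and (ii) G₃(y) = ∫_y^1 x^{−1} G₃(x) u(x) dx for every y ∈ (0,1). -/

import Mathlib

open MeasureTheory Set

/-- `G₃(y) = Σ_{m≥0} (3m)!/(3^m m!)³ (1−y)^m`, the power-series factor in the density of
the statistic `Y` for sample size `n = 3`. -/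
noncomputable def G₃ (y : ℝ) : ℝ :=
  ∑' m : ℕ, ((Nat.factorial (3 * m) : ℝ) / ((3 ^ m * Nat.factorial m : ℕ) : ℝ) ^ 3) *
    (1 - y) ^ m

theorem factorial_three_mul_le (m : ℕ) :
    Nat.factorial (3 * m) ≤ (3 ^ m * Nat.factorial m) ^ 3 := by
  induction m with
  | zero => simp
  | succ m ih =>
    rw [show 3 * (m + 1) = 3 * m + 2 + 1 by ring, Nat.factorial_succ, Nat.factorial_succ,
      Nat.factorial_succ, Nat.factorial_succ]
    calc (3 * m + 2 + 1) * ((3 * m + 1 + 1) * ((3 * m + 1) * Nat.factorial (3 * m)))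
        ≤ (3 * m + 3) * ((3 * m + 3) * ((3 * m + 3) * (3 ^ m * Nat.factorial m) ^ 3)) := by
          have h1 : 3 * m + 1 + 1 ≤ 3 * m + 3 := by omega
          have h2 : 3 * m + 1 ≤ 3 * m + 3 := by omega
          gcongr
      _ = (3 ^ (m + 1) * ((m + 1) * Nat.factorial m)) ^ 3 := by ring

theorem summable_G₃ {y : ℝ} (hy : y ∈ Ioo (0 : ℝ) 1) :
    Summable (fun m : ℕ =>
      ((Nat.factorial (3 * m) : ℝ) / ((3 ^ m * Nat.factorial m : ℕ) : ℝ) ^ 3) *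
        (1 - y) ^ m) := by
  have h0 : 0 ≤ 1 - y := by linarith [hy.2]
  refine Summable.of_nonneg_of_le (fun m => by positivity) (fun m => ?_)
    (summable_geometric_of_lt_one h0 (by linarith [hy.1]))
  refine mul_le_of_le_one_left (pow_nonneg h0 m) (div_le_one_of_le₀ ?_ (by positivity))
  exact_mod_cast factorial_three_mul_le m

theorem one_le_G₃ {y : ℝ} (hy : y ∈ Ioo (0 : ℝ) 1) : 1 ≤ G₃ y := by
  have h0 : 0 ≤ 1 - y := by linarith [hy.2]
  simpa [G₃] using (summable_G₃ hy).le_tsum 0 (fun m _ => by positivity)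

/-- The integral over `(y, b)` of a function integrable near `b` vanishes as `y → b` from the
left. -/
theorem tendsto_setIntegral_Ioo_nhdsLT {f : ℝ → ℝ} {a b : ℝ} (hab : a < b)
    (hf : IntegrableOn f (Ioo a b)) :
    Filter.Tendsto (fun y => ∫ x in Ioo y b, f x) (nhdsWithin b (Iio b)) (nhds 0) := by
  have hvol : Filter.Tendsto (fun y => volume.restrict (Ioo a b) (Ioo y b))
      (nhdsWithin b (Iio b)) (nhds 0) := by
    have hlen : Filter.Tendsto (fun y => volume (Ioo y b)) (nhdsWithin b (Iio b)) (nhds 0) := by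
      simp only [Real.volume_Ioo]
      have h : Continuous fun y : ℝ => ENNReal.ofReal (b - y) :=
        ENNReal.continuous_ofReal.comp (by fun_prop)
      simpa using (h.tendsto b).mono_left nhdsWithin_le_nhds
    exact tendsto_of_tendsto_of_tendsto_of_le_of_le tendsto_const_nhds hlen
      (fun _ => zero_le) (fun _ => Measure.restrict_le_self _)
  refine (hf.tendsto_setIntegral_nhds_zero hvol).congr' ?_
  filter_upwards [Ioo_mem_nhdsLT hab] with y hy
  rw [Measure.restrict_restrict measurableSet_Ioo,
    inter_eq_left.mpr (Ioo_subset_Ioo_left hy.1.le)]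

/-- Nonexistence of an unbiased estimator of the shape parameter for sample size `n = 3`:
the series defining `G₃` converges on `(0,1)`, and no Lebesgue measurable `u : (0,1) → ℝ`
with `∫₀¹ x^{α−1} G₃(x)|u(x)| dx < ∞` for all `α > 0` can satisfy
`G₃(y) = ∫_y^1 x^{−1} G₃(x) u(x) dx` for all `y ∈ (0,1)`. -/
theorem no_unbiased_estimator_shape_n_three :
    (∀ y ∈ Ioo (0:ℝ) 1,
      Summable (fun m : ℕ =>
        ((Nat.factorial (3 * m) : ℝ) / ((3 ^ m * Nat.factorial m : ℕ) : ℝ) ^ 3) *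
          (1 - y) ^ m)) ∧
    ¬ ∃ u : ℝ → ℝ, AEMeasurable u volume ∧
      (∀ a > (0:ℝ), IntegrableOn (fun x => x ^ (a - 1) * G₃ x * |u x|) (Ioo 0 1)) ∧
      (∀ y ∈ Ioo (0:ℝ) 1, G₃ y = ∫ x in Ioo y 1, x⁻¹ * G₃ x * u x) := by
  refine ⟨fun y hy => summable_G₃ hy, ?_⟩
  rintro ⟨u, -, -, hu⟩
  have hhalf : (1 / 2 : ℝ) ∈ Ioo (0 : ℝ) 1 := by constructor <;> norm_num
  have hint : IntegrableOn (fun x => x⁻¹ * G₃ x * u x) (Ioo (1 / 2) 1) := by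
    by_contra h
    have h1 := one_le_G₃ hhalf
    rw [hu _ hhalf, integral_undef h] at h1
    norm_num at h1
  have hle : (1 : ℝ) ≤ 0 := by
    refine ge_of_tendsto (tendsto_setIntegral_Ioo_nhdsLT hhalf.2 hint) ?_
    filter_upwards [Ioo_mem_nhdsLT (zero_lt_one' ℝ)] with y hy
    exact hu y hy ▸ one_le_G₃ hy
  norm_num at hle
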